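/- arXiv:2003.03769 — 2 statements merged into one kernel-verified Lean document; each statement's English description precedes it below -/
import Mathlib

section
/- Let n ≥ 1. There is no constant C ∈ ℝ such that for every Schwartz function f : ℝⁿ → ℂ one has ‖f(0)‖² ≤ C · ∫_{ℝⁿ} ‖ξ‖ⁿ · ‖(𝓕 f)(ξ)‖² dξ. In other words, the evaluation functional at the origin is unbounded with respect to the homogeneous Sobolev norm of order n/2; this is the failure of the critical case of the Sobolev embedding. -/
open MeasureTheory SchwartzMap
open scoped FourierTransform ContDiff

section DyadicDilation

variable {V : Type*} [NormedAddCommGroup V] [InnerProductSpace ℝ V]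

/-- The dilation `x ↦ 2 ^ (k * dim V) * g (2 ^ k • x)`, normalized to preserve the integral. -/
noncomputable def dyadicDilation (g : V → ℝ) (k : ℕ) (x : V) : ℝ :=
  ((2 : ℝ) ^ k) ^ Module.finrank ℝ V * g ((2 : ℝ) ^ k • x)

theorem ContDiff.dyadicDilation {g : V → ℝ} (hg : ContDiff ℝ ∞ g) (k : ℕ) :
    ContDiff ℝ ∞ (dyadicDilation g k) :=
  contDiff_const.mul (hg.comp (contDiff_const_smul _))

theorem HasCompactSupport.dyadicDilation {g : V → ℝ} (hg : HasCompactSupport g) (k : ℕ) :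
    HasCompactSupport (dyadicDilation g k) :=
  (hg.comp_smul (pow_ne_zero k two_ne_zero)).mul_left

/-- Dyadic dilations of a function supported in the annulus `1 < ‖x‖ < 2` have pairwise disjoint
supports. -/
theorem dyadicDilation_eq_zero_of_ne {g : V → ℝ}
    (hg : ∀ x, g x ≠ 0 → 1 < ‖x‖ ∧ ‖x‖ < 2) {j k : ℕ} (hjk : j ≠ k) {x : V}
    (hx : dyadicDilation g j x ≠ 0) : dyadicDilation g k x = 0 := by
  have annulus : ∀ i, dyadicDilation g i x ≠ 0 → 1 < 2 ^ i * ‖x‖ ∧ 2 ^ i * ‖x‖ < 2 := by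
    intro i hi
    simpa [norm_smul] using hg _ (right_ne_zero_of_mul hi)
  have separated : ∀ i l, i < l → 1 < 2 ^ i * ‖x‖ → ¬ 2 ^ l * ‖x‖ < 2 := by
    intro i l hil hi
    have hpow : (2 : ℝ) ^ (i + 1) ≤ 2 ^ l := pow_le_pow_right₀ one_le_two hil
    have := mul_le_mul_of_nonneg_right hpow (norm_nonneg x)
    rw [pow_succ] at this
    linarith
  by_contra hk
  rcases hjk.lt_or_gt with h | h
  · exact separated j k h (annulus j hx).1 (annulus k hk).2
  · exact separated k j h (annulus k hk).1 (annulus j hx).2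

theorem sq_sum_dyadicDilation {g : V → ℝ} (hg : ∀ x, g x ≠ 0 → 1 < ‖x‖ ∧ ‖x‖ < 2)
    (s : Finset ℕ) (x : V) :
    (∑ k ∈ s, dyadicDilation g k x) ^ 2 = ∑ k ∈ s, dyadicDilation g k x ^ 2 := by
  rw [sq, Finset.sum_mul_sum]
  refine Finset.sum_congr rfl fun j hj ↦ ?_
  rw [Finset.sum_eq_single_of_mem j hj, sq]
  intro k _ hkj
  by_cases hx : dyadicDilation g j x = 0
  · rw [hx, zero_mul]
  · rw [dyadicDilation_eq_zero_of_ne hg hkj.symm hx, mul_zero]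

variable [FiniteDimensional ℝ V] [MeasurableSpace V] [BorelSpace V]

theorem integral_dyadicDilation (g : V → ℝ) (k : ℕ) :
    ∫ x, dyadicDilation g k x = ∫ x, g x := by
  simp only [dyadicDilation]
  rw [integral_const_mul, Measure.integral_comp_smul_of_nonneg _ _ _ (hR := by positivity),
    smul_eq_mul, mul_inv_cancel_left₀ (by positivity)]

theorem integral_norm_pow_mul_dyadicDilation_sq (g : V → ℝ) (k : ℕ) :
    ∫ x : V, ‖x‖ ^ Module.finrank ℝ V * dyadicDilation g k x ^ 2 =
      ∫ x : V, ‖x‖ ^ Module.finrank ℝ V * g x ^ 2 := by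
  rw [← integral_dyadicDilation (fun x ↦ ‖x‖ ^ Module.finrank ℝ V * g x ^ 2) k]
  congr 1 with x
  simp only [dyadicDilation, norm_smul, norm_pow, Real.norm_ofNat, mul_pow]
  ring

/-- A Sobolev-type bound for evaluation at the origin, expressed for the Fourier transform `h` of
the function being evaluated. -/
theorem sq_integral_le_of_sq_norm_apply_zero_le {C : ℝ} {m : ℕ}
    (hC : ∀ f : SchwartzMap V ℂ, ‖f 0‖ ^ 2 ≤ C * ∫ ξ : V, ‖ξ‖ ^ m * ‖𝓕 (⇑f) ξ‖ ^ 2)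
    {h : V → ℝ} (h_smooth : ContDiff ℝ ∞ h) (h_supp : HasCompactSupport h) :
    (∫ x, h x) ^ 2 ≤ C * ∫ ξ : V, ‖ξ‖ ^ m * h ξ ^ 2 := by
  have h_supp' : HasCompactSupport fun x ↦ (h x : ℂ) := h_supp.comp_left Complex.ofReal_zero
  let F : SchwartzMap V ℂ := h_supp'.toSchwartzMap (Complex.ofRealCLM.contDiff.comp h_smooth)
  have hF : ∀ x, F x = h x := fun _ ↦ rfl
  have h_zero : (𝓕⁻ F) 0 = ((∫ x, h x : ℝ) : ℂ) := by
    rw [fourierInv_coe, Real.fourierInv_eq]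
    simp [hF, integral_complex_ofReal]
  have := hC (𝓕⁻ F)
  rw [h_zero, ← fourier_coe, FourierTransform.fourier_fourierInv_eq] at this
  simpa [hF] using this

end DyadicDilation

/-- Lemma 1.4 (Euclidean case): the evaluation functional at the origin is not
bounded with respect to the homogeneous Sobolev norm of critical order `n/2`:
there is no constant `C` with `‖f 0‖² ≤ C ∫ ‖ξ‖ⁿ ‖𝓕 f ξ‖²` for all Schwartz `f`. -/
theorem stmt2 (n : ℕ) (hn : 1 ≤ n) :
    ¬ ∃ C : ℝ, ∀ f : SchwartzMap (EuclideanSpace ℝ (Fin n)) ℂ,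
        ‖f 0‖ ^ 2 ≤ C * ∫ ξ : EuclideanSpace ℝ (Fin n), ‖ξ‖ ^ n * ‖𝓕 (⇑f) ξ‖ ^ 2 := by
  rintro ⟨C, hC⟩
  let e : EuclideanSpace ℝ (Fin n) := EuclideanSpace.single ⟨0, hn⟩ (3 / 2)
  have he : ‖e‖ = 3 / 2 := by simp [e]
  let g : ContDiffBump e := ⟨1 / 4, 1 / 2, by norm_num, by norm_num⟩
  have hg : ∀ x, g x ≠ 0 → 1 < ‖x‖ ∧ ‖x‖ < 2 := by
    intro x hx
    have hxe : ‖x - e‖ < 1 / 2 := by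
      rw [← Function.mem_support, g.support_eq, mem_ball_iff_norm] at hx
      exact hx
    have h₁ := norm_sub_norm_le x e
    have h₂ := norm_sub_norm_le e x
    rw [norm_sub_rev] at h₂
    constructor <;> linarith
  have g_smooth : ContDiff ℝ ∞ g := g.contDiff
  set E := ∫ ξ, ‖ξ‖ ^ n * g ξ ^ 2 with hE
  have bound : ∀ N : ℕ, (N * ∫ x, g x) ^ 2 ≤ C * (N * E) := by
    intro N
    have smooth := g_smooth.dyadicDilation
    have supp := g.hasCompactSupport.dyadicDilation
    have sum_supp : HasCompactSupport fun x ↦ ∑ k ∈ Finset.range N, dyadicDilation g k x := by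
      induction N with
      | zero =>
        simp only [Finset.range_zero, Finset.sum_empty]
        exact HasCompactSupport.zero
      | succ N ih =>
        simp only [Finset.sum_range_succ]
        exact ih.add (supp N)
    have key := sq_integral_le_of_sq_norm_apply_zero_le hC
      (ContDiff.sum fun k (_ : k ∈ Finset.range N) ↦ smooth k) sum_supp
    have energy : ∀ k, ∫ ξ, ‖ξ‖ ^ n * dyadicDilation g k ξ ^ 2 = E := by
      intro k
      simpa using integral_norm_pow_mul_dyadicDilation_sq g k
    simp only [sq_sum_dyadicDilation hg, Finset.mul_sum] at key
    rw [integral_finsetSum, integral_finsetSum] at key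
    · simpa [integral_dyadicDilation, energy] using key
    · intro k _
      refine Continuous.integrable_of_hasCompactSupport
        ((continuous_norm.pow n).mul ((smooth k).continuous.pow 2)) ?_
      exact ((supp k).comp_left (g := fun t : ℝ ↦ t ^ 2) (by simp)).mul_left
    · intro k _
      exact (smooth k).continuous.integrable_of_hasCompactSupport (supp k)
  have hI : 0 < (∫ x, g x) ^ 2 := pow_pos g.integral_pos 2
  obtain ⟨N, hN⟩ := exists_nat_gt (C * E / (∫ x, g x) ^ 2)
  rw [div_lt_iff₀ hI] at hN
  have h₁ := bound (N + 1)
  have hN_pos : (0 : ℝ) < ((N + 1 : ℕ) : ℝ) := by positivity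
  have h₂ : ((N + 1 : ℕ) : ℝ) * (∫ x, g x) ^ 2 ≤ C * E := by
    refine le_of_mul_le_mul_left ?_ hN_pos
    linarith
  push_cast at h₂
  linarith
end

section
/- Let n ≥ 1 and let ε > 0. There exists a sequence (f_k) of smooth, compactly supported functions f_k : ℝⁿ → ℝ whose supports are contained in the open ball of radius ε around 0, such that ∫_{ℝⁿ} ‖ξ‖ⁿ · ‖(𝓕 f_k)(ξ)‖² dξ ≤ 1 for every k, while f_k(0) → +∞ as k → ∞. -/
open MeasureTheory
open scoped FourierTransform

/-- A finite sequence of nonnegative reals dominated by a geometric sequence of ratio `r ≤ 1 / 2`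
has square-sum controlled linearly, with geometric weights. -/
theorem sum_le_and_sq_sum_le_of_le_geometric {r : ℝ} (hr0 : 0 ≤ r) (hr : r ≤ 1 / 2) (N : ℕ) :
    ∀ (a : ℕ → ℝ) (M : ℝ), 0 ≤ M → (∀ j, 0 ≤ a j) → (∀ j, a j ≤ M * r ^ j) →
      ∑ j ∈ Finset.range N, a j ≤ 2 * M ∧
      (∑ j ∈ Finset.range N, a j) ^ 2 ≤ 4 * M * ∑ j ∈ Finset.range N, r ^ j * a j := by
  induction N with
  | zero => intro a M hM _ _; simpa using hM
  | succ N ih =>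
    intro a M hM ha hle
    obtain ⟨h1, h2⟩ := ih (fun j => a (j + 1)) (M * r) (by positivity) (fun j => ha _)
      (fun j => (hle (j + 1)).trans_eq (by ring))
    have h0 : a 0 ≤ M := by simpa using hle 0
    have h00 := ha 0
    have hMr : 2 * (M * r) ≤ M := by nlinarith
    have e : ∑ j ∈ Finset.range N, r ^ (j + 1) * a (j + 1)
        = r * ∑ j ∈ Finset.range N, r ^ j * a (j + 1) := by
      rw [Finset.mul_sum]
      exact Finset.sum_congr rfl fun j _ => by ring
    rw [Finset.sum_range_succ', Finset.sum_range_succ', e]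
    set S := ∑ j ∈ Finset.range N, a (j + 1)
    set T := ∑ j ∈ Finset.range N, r ^ j * a (j + 1)
    refine ⟨by linarith, ?_⟩
    have hS : a 0 * S ≤ a 0 * M := mul_le_mul_of_nonneg_left (h1.trans hMr) h00
    have hA : a 0 * a 0 ≤ a 0 * M := mul_le_mul_of_nonneg_left h0 h00
    have hM0 : 0 ≤ a 0 * M := mul_nonneg h00 hM
    simp only [pow_zero, one_mul]
    nlinarith

section Fourier

variable {V : Type*} [NormedAddCommGroup V] [InnerProductSpace ℝ V] [FiniteDimensional ℝ V]
  [MeasurableSpace V] [BorelSpace V]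

theorem fourier_comp_smul {E : Type*} [NormedAddCommGroup E] [NormedSpace ℂ E]
    (f : V → E) {c : ℝ} (hc : c ≠ 0) (ξ : V) :
    𝓕 (fun x => f (c • x)) ξ = |(c ^ Module.finrank ℝ V)⁻¹| • 𝓕 f (c⁻¹ • ξ) := by
  rw [Real.fourier_eq, Real.fourier_eq, ← Measure.integral_comp_smul]
  congr 1
  ext v
  rw [real_inner_smul_left, real_inner_smul_right, mul_inv_cancel_left₀ hc]

theorem fourier_finset_sum {E ι : Type*} [NormedAddCommGroup E] [NormedSpace ℂ E]
    (s : Finset ι) (f : ι → V → E) (hf : ∀ i ∈ s, Integrable (f i)) (ξ : V) :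
    𝓕 (fun x => ∑ i ∈ s, f i x) ξ = ∑ i ∈ s, 𝓕 (f i) ξ := by
  simp only [Real.fourier_eq, Finset.smul_sum]
  exact integral_finsetSum s fun i hi =>
    (Real.fourierIntegral_convergent_iff (μ := volume) ξ).2 (hf i hi)

theorem fourier_const_mul (f : V → ℂ) (c : ℂ) (ξ : V) :
    𝓕 (fun x => c * f x) ξ = c * 𝓕 f ξ := by
  simp only [Real.fourier_eq, ← integral_const_mul, mul_smul_comm]

/-- The squared critical homogeneous Sobolev seminorm of a sum of `N` dyadic dilates of a Schwartz
function grows at most linearly in `N`. -/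
theorem exists_integral_norm_pow_mul_sq_fourier_sum_dilates_le (hV : 1 ≤ Module.finrank ℝ V)
    (φ : SchwartzMap V ℂ) :
    ∃ C : ℝ, 0 < C ∧ ∀ N : ℕ,
      ∫ ξ : V, ‖ξ‖ ^ Module.finrank ℝ V *
        ‖𝓕 (fun x => ∑ j ∈ Finset.range N, φ ((2 ^ j : ℝ) • x)) ξ‖ ^ 2 ≤ C * N := by
  set n := Module.finrank ℝ V with hn
  set M : ℝ := ∫ x, ‖φ x‖
  set K : ℝ := ∫ ξ : V, ‖ξ‖ ^ n * ‖𝓕 (φ : V → ℂ) ξ‖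
  have hM : 0 ≤ M := integral_nonneg fun _ => norm_nonneg _
  have hK : 0 ≤ K := integral_nonneg fun _ => by positivity
  have hKi : Integrable (fun ξ : V => ‖ξ‖ ^ n * ‖𝓕 (φ : V → ℂ) ξ‖) := by
    simpa [SchwartzMap.fourier_coe] using (𝓕 φ).integrable_pow_mul volume n
  set r : ℝ := (2 ^ n)⁻¹ with hr
  have hr0 : 0 < r := by positivity
  have hr2 : r ≤ 1 / 2 := by
    rw [hr, one_div]
    exact inv_anti₀ two_pos (le_self_pow₀ one_le_two (by lia))
  have hrj (j : ℕ) : r ^ j = ((2 ^ j : ℝ) ^ n)⁻¹ := by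
    rw [hr, inv_pow, ← pow_mul, ← pow_mul, mul_comm]
  have hrjn (j : ℕ) : r ^ j * (2 ^ j : ℝ) ^ n = 1 := by
    rw [hrj]; exact inv_mul_cancel₀ (by positivity)
  set a : V → ℕ → ℝ := fun ξ j => r ^ j * ‖𝓕 (φ : V → ℂ) ((2 ^ j : ℝ)⁻¹ • ξ)‖ with ha
  have hwt (j : ℕ) (ξ : V) : ‖ξ‖ ^ n * (r ^ j * a ξ j) = r ^ j *
      (‖(2 ^ j : ℝ)⁻¹ • ξ‖ ^ n * ‖𝓕 (φ : V → ℂ) ((2 ^ j : ℝ)⁻¹ • ξ)‖) := by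
    rw [norm_smul, norm_inv, Real.norm_of_nonneg (by positivity : (0 : ℝ) ≤ 2 ^ j), mul_pow,
      inv_pow (2 ^ j : ℝ) n, ← hrj]
    simp only [ha]; ring
  have hint (j : ℕ) : Integrable fun ξ : V => ‖ξ‖ ^ n * (r ^ j * a ξ j) := by
    simp only [hwt]
    exact (hKi.comp_smul (R := (2 ^ j : ℝ)⁻¹) (by positivity)).const_mul _
  have hval (j : ℕ) : ∫ ξ : V, ‖ξ‖ ^ n * (r ^ j * a ξ j) = K := by
    simp only [hwt]
    rw [integral_const_mul, Measure.integral_comp_inv_smul_of_nonneg volume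
      (fun ξ : V => ‖ξ‖ ^ n * ‖𝓕 (φ : V → ℂ) ξ‖) (by positivity : (0 : ℝ) ≤ 2 ^ j),
      smul_eq_mul, ← mul_assoc, hrjn, one_mul]
  refine ⟨4 * M * K + 1, by positivity, fun N => ?_⟩
  have hpt (ξ : V) : ‖ξ‖ ^ n *
      ‖𝓕 (fun x => ∑ j ∈ Finset.range N, φ ((2 ^ j : ℝ) • x)) ξ‖ ^ 2 ≤
      4 * M * ∑ j ∈ Finset.range N, ‖ξ‖ ^ n * (r ^ j * a ξ j) := by
    have hle : ‖𝓕 (fun x => ∑ j ∈ Finset.range N, φ ((2 ^ j : ℝ) • x)) ξ‖ ≤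
        ∑ j ∈ Finset.range N, a ξ j := by
      rw [fourier_finset_sum _ (fun j x => φ ((2 ^ j : ℝ) • x))
        fun j _ => φ.integrable.comp_smul (by positivity)]
      refine (norm_sum_le _ _).trans_eq (Finset.sum_congr rfl fun j _ => ?_)
      rw [fourier_comp_smul (φ : V → ℂ) (by positivity), norm_smul, Real.norm_eq_abs, abs_abs,
        ← hn, ← hrj, abs_of_pos (by positivity)]
    have hsq := (sum_le_and_sq_sum_le_of_le_geometric hr0.le hr2 N (a ξ) M hM
      (fun j => by positivity) fun j => by
        rw [mul_comm M]
        exact mul_le_mul_of_nonneg_left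
          (VectorFourier.norm_fourierIntegral_le_integral_norm _ _ _ _ _) (by positivity)).2
    calc _ ≤ ‖ξ‖ ^ n * (4 * M * ∑ j ∈ Finset.range N, r ^ j * a ξ j) := by
          gcongr
          exact (pow_le_pow_left₀ (norm_nonneg _) hle 2).trans hsq
      _ = _ := by rw [← Finset.mul_sum]; ring
  calc _ ≤ ∫ ξ : V, 4 * M * ∑ j ∈ Finset.range N, ‖ξ‖ ^ n * (r ^ j * a ξ j) :=
        integral_mono_of_nonneg (Filter.Eventually.of_forall fun ξ => by positivity)
          ((integrable_finsetSum _ fun j _ => hint j).const_mul _)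
          (Filter.Eventually.of_forall hpt)
    _ = 4 * M * K * N := by
        rw [integral_const_mul, integral_finsetSum _ fun j _ => hint j]
        simp only [hval, Finset.sum_const, Finset.card_range, nsmul_eq_mul]
        ring
    _ ≤ _ := by gcongr; linarith

end Fourier

/-- Conditions 6 and 7 of Section 2.3 (Euclidean case): there are smooth bumps
supported in an arbitrarily small ball around the origin with uniformly bounded
critical homogeneous Sobolev norm whose values at the origin blow up. -/
theorem stmt3 (n : ℕ) (hn : 1 ≤ n) (ε : ℝ) (hε : 0 < ε) :
    ∃ f : ℕ → EuclideanSpace ℝ (Fin n) → ℝ,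
      (∀ k, ContDiff ℝ (⊤ : ℕ∞) (f k)) ∧
      (∀ k, HasCompactSupport (f k)) ∧
      (∀ k, Function.support (f k) ⊆ Metric.ball 0 ε) ∧
      (∀ k, ∫ ξ : EuclideanSpace ℝ (Fin n),
          ‖ξ‖ ^ n * ‖𝓕 (fun x => (f k x : ℂ)) ξ‖ ^ 2 ≤ 1) ∧
      Filter.Tendsto (fun k => f k 0) Filter.atTop Filter.atTop := by
  let b : ContDiffBump (0 : EuclideanSpace ℝ (Fin n)) := ⟨ε / 2, ε, by positivity, by linarith⟩
  have hbc : HasCompactSupport fun x => (b x : ℂ) :=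
    b.hasCompactSupport.comp_left (g := fun t : ℝ => (t : ℂ)) Complex.ofReal_zero
  have hbs : ContDiff ℝ (⊤ : ℕ∞) fun x => (b x : ℂ) := Complex.ofRealCLM.contDiff.comp b.contDiff
  have hrank : Module.finrank ℝ (EuclideanSpace ℝ (Fin n)) = n := finrank_euclideanSpace_fin
  obtain ⟨C, hC, hbound⟩ := exists_integral_norm_pow_mul_sq_fourier_sum_dilates_le
    (by rwa [hrank]) (hbc.toSchwartzMap hbs)
  rw [hrank] at hbound
  let c : ℕ → ℝ := fun k => (√(C * ((k + 1 : ℕ) : ℝ)))⁻¹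
  let f : ℕ → EuclideanSpace ℝ (Fin n) → ℝ := fun k x =>
    c k * ∑ j ∈ Finset.range (k + 1), b ((2 ^ j : ℝ) • x)
  have hsupp (k : ℕ) : Function.support (f k) ⊆ Metric.ball 0 ε := by
    intro x hx
    by_contra hxε
    refine hx (mul_eq_zero_of_right _ (Finset.sum_eq_zero fun j _ => b.zero_of_le_dist ?_))
    rw [mem_ball_zero_iff, not_lt] at hxε
    rw [dist_zero_right, norm_smul, Real.norm_of_nonneg (by positivity)]
    exact hxε.trans (le_mul_of_one_le_left (norm_nonneg _) (one_le_pow₀ one_le_two))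
  refine ⟨f, fun k => ?_, fun k => ?_, hsupp, fun k => ?_, ?_⟩
  · exact contDiff_const.mul (ContDiff.sum fun j _ => b.contDiff.comp (contDiff_const_smul _))
  · exact HasCompactSupport.of_support_subset_isCompact (isCompact_closedBall 0 ε)
      ((hsupp k).trans Metric.ball_subset_closedBall)
  · have hf : (fun x => (f k x : ℂ)) = fun x => (c k : ℂ) *
        ∑ j ∈ Finset.range (k + 1), hbc.toSchwartzMap hbs ((2 ^ j : ℝ) • x) := by
      ext x
      simp [f]
    have hck : c k ^ 2 * (C * ((k + 1 : ℕ) : ℝ)) = 1 := by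
      simp only [c]
      rw [inv_pow, Real.sq_sqrt (by positivity)]
      exact inv_mul_cancel₀ (by positivity)
    simp only [hf, fourier_const_mul, norm_mul, mul_pow, Complex.norm_real, Real.norm_eq_abs,
      sq_abs, mul_left_comm _ (c k ^ 2)]
    rw [integral_const_mul, ← hck]
    exact mul_le_mul_of_nonneg_left (hbound (k + 1)) (sq_nonneg _)
  · have hb0 : b 0 = 1 := b.eventuallyEq_one.eq_of_nhds
    have hf0 : (fun k => f k 0) = fun k => (√C)⁻¹ * √((k + 1 : ℕ) : ℝ) := by
      ext k
      have hs : (0 : ℝ) < √((k + 1 : ℕ) : ℝ) := Real.sqrt_pos.2 (by positivity)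
      have hsC : (0 : ℝ) < √C := Real.sqrt_pos.2 hC
      have hq : √((k + 1 : ℕ) : ℝ) * √((k + 1 : ℕ) : ℝ) = ((k + 1 : ℕ) : ℝ) :=
        Real.mul_self_sqrt (by positivity)
      simp only [f, c, smul_zero, hb0, Finset.sum_const, Finset.card_range, nsmul_eq_mul, mul_one]
      rw [Real.sqrt_mul hC.le, mul_inv, mul_assoc]
      congr 1
      rw [inv_mul_eq_iff_eq_mul₀ hs.ne', hq]
    rw [hf0]
    exact (Real.tendsto_sqrt_atTop.comp (tendsto_natCast_atTop_atTop.comp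
      (Filter.tendsto_add_atTop_nat 1))).const_mul_atTop (inv_pos.2 (Real.sqrt_pos.2 hC))
end
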